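/- (First-token stability under sufficient lookahead.) Let D be a proper byte pair dictionary and let k = |D|·max{|uv| : u⌢v ∈ D} be its sufficient lookahead. If w is a string with |w| ≥ k and 𝕋^D(w) = u⌢τ for a token u and tokenization τ, then for every string w' there exists a tokenization τ' such that 𝕋^D(ww') = u⌢τ'. -/

import Mathlib

/-!
Formalization of byte pair encoding (BPE) tokenization semantics.

* The alphabet is a type `α`.
* A *token* is a (intended nonempty) string over `α`, i.e. a `List α`.
* A *tokenization* is a finite sequence of tokens.
* A *byte pair dictionary* is a finite sequence of rules (pairs of tokens),
  listed in order of decreasing priority.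
-/

/-- A token: a string over the alphabet `α`. -/
abbrev Token (α : Type*) := List α

/-- A tokenization: a finite sequence of tokens. -/
abbrev Tok (α : Type*) := List (Token α)

/-- A byte pair dictionary: a finite sequence of rules, in decreasing priority order. -/
abbrev Dict (α : Type*) := List (Token α × Token α)

variable {α : Type*}

/-- `π`: concatenation of the tokens of a tokenization. -/
def pi (τ : Tok α) : List α := τ.flatten

/-- All tokens of a tokenization are nonempty strings. -/
def NETok (τ : Tok α) : Prop := ∀ u ∈ τ, u ≠ []

/-- All rules of a dictionary consist of nonempty tokens. -/
def NEDict (D : Dict α) : Prop := ∀ r ∈ D, r.1 ≠ [] ∧ r.2 ≠ []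

/-- `Tk∅(w)`: the initial tokenization of `w` into single symbols. -/
def TkEmpty (w : List α) : Tok α := w.map (fun a => [a])

/-- Rule `r` applies in tokenization `τ` at position `p`
(i.e. `τ = φ ⌢ r.1 ⌢ r.2 ⌢ φ'` with `|φ| = p`). -/
def AppliesAt (r : Token α × Token α) (τ : Tok α) (p : ℕ) : Prop :=
  ∃ φ φ' : Tok α, φ.length = p ∧ τ = φ ++ r.1 :: r.2 :: φ'

/-- Rule `r` applies somewhere in tokenization `τ`. -/
def Applies (r : Token α × Token α) (τ : Tok α) : Prop := ∃ p, AppliesAt r τ p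

/-- The result of applying (merging by) rule `r` at position `p` in `τ`. -/
def applyAt (r : Token α × Token α) (τ : Tok α) (p : ℕ) : Tok α :=
  τ.take p ++ (r.1 ++ r.2) :: τ.drop (p + 2)

/-- The base (nondeterministic) rewriting step `τ ⇒ τ'`: some rule of `D`
is applied somewhere in `τ`. -/
def BStep (D : Dict α) (τ τ' : Tok α) : Prop :=
  ∃ (φ φ' : Tok α) (u v : Token α),
    (u, v) ∈ D ∧ τ = φ ++ u :: v :: φ' ∧ τ' = φ ++ (u ++ v) :: φ'

/-- `τ` is a base tokenization of `w`: reachable from `Tk∅(w)` by base steps,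
and no rule of `D` applies to it. -/
def IsBase (D : Dict α) (w : List α) (τ : Tok α) : Prop :=
  Relation.ReflTransGen (BStep D) (TkEmpty w) τ ∧ ∀ τ', ¬ BStep D τ τ'

/-- `BStepN D n τ τ'`: `τ'` is obtained from `τ` by exactly `n` base steps. -/
def BStepN (D : Dict α) : ℕ → Tok α → Tok α → Prop
  | 0 => Eq
  | n + 1 => fun τ τ'' => ∃ τ', BStepN D n τ τ' ∧ BStep D τ' τ''

/-- One SentencePiece step applying the rule of index `i` (highest priority
applicable) at position `p` (leftmost occurrence of that rule). -/
def SPStepAt (D : Dict α) (i p : ℕ) (τ τ' : Tok α) : Prop :=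
  ∃ h : i < D.length,
    AppliesAt (D[i]'h) τ p ∧
    (∀ (j : ℕ) (hj : j < D.length), j < i → ¬ Applies (D[j]'hj) τ) ∧
    (∀ q < p, ¬ AppliesAt (D[i]'h) τ q) ∧
    τ' = applyAt (D[i]'h) τ p

/-- One SentencePiece step: the highest priority applicable rule is applied
at its leftmost occurrence. -/
def SPStep (D : Dict α) (τ τ' : Tok α) : Prop := ∃ i p, SPStepAt D i p τ τ'

/-- One SentencePiece step which applies the rule `r` of `D`. -/
def SPStepRule (D : Dict α) (r : Token α × Token α) (τ τ' : Tok α) : Prop :=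
  ∃ (i p : ℕ) (h : i < D.length), D[i]'h = r ∧ SPStepAt D i p τ τ'

/-- `τ` is the SentencePiece tokenization `𝕋^D(w)` of `w`: reachable from
`Tk∅(w)` by SentencePiece steps, and no further step applies. -/
def IsSP (D : Dict α) (w : List α) (τ : Tok α) : Prop :=
  Relation.ReflTransGen (SPStep D) (TkEmpty w) τ ∧ ∀ τ', ¬ SPStep D τ τ'

/-- One application of rule `r` at its leftmost occurrence. -/
def LeftStep (r : Token α × Token α) (τ τ' : Tok α) : Prop :=
  ∃ p, AppliesAt r τ p ∧ (∀ q < p, ¬ AppliesAt r τ q) ∧ τ' = applyAt r τ p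

/-- Exhaustive application of rule `r`, leftmost first, until it no longer applies. -/
def Exhaust (r : Token α × Token α) (τ τ' : Tok α) : Prop :=
  Relation.ReflTransGen (LeftStep r) τ τ' ∧ ¬ Applies r τ'

/-- One HuggingFace (macro) step using the rule of index `i`: the rule of
index `i` is the highest-priority applicable rule, and it is applied
repeatedly at its leftmost occurrence until it no longer applies. -/
def HFStepAt (D : Dict α) (i : ℕ) (τ τ' : Tok α) : Prop :=
  ∃ h : i < D.length,
    Applies (D[i]'h) τ ∧
    (∀ (j : ℕ) (hj : j < D.length), j < i → ¬ Applies (D[j]'hj) τ) ∧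
    Exhaust (D[i]'h) τ τ'

/-- One HuggingFace (macro) step. -/
def HFStep (D : Dict α) (τ τ' : Tok α) : Prop := ∃ i, HFStepAt D i τ τ'

/-- One HuggingFace (macro) step which uses the rule `r` of `D`. -/
def HFStepRule (D : Dict α) (r : Token α × Token α) (τ τ' : Tok α) : Prop :=
  ∃ (i : ℕ) (h : i < D.length), D[i]'h = r ∧ HFStepAt D i τ τ'

/-- `τ` is the HuggingFace tokenization `𝕋_hf^D(w)` of `w`. -/
def IsHF (D : Dict α) (w : List α) (τ : Tok α) : Prop :=
  Relation.ReflTransGen (HFStep D) (TkEmpty w) τ ∧ ∀ τ', ¬ HFStep D τ τ'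

/-- A dictionary is *proper* if each side of each rule of length `> 1` is
produced by some higher-priority rule. -/
def Proper (D : Dict α) : Prop :=
  ∀ (j : ℕ) (hj : j < D.length),
    (1 < (D[j]'hj).1.length →
      ∃ (i : ℕ) (hi : i < D.length), i < j ∧ (D[j]'hj).1 = (D[i]'hi).1 ++ (D[i]'hi).2) ∧
    (1 < (D[j]'hj).2.length →
      ∃ (i : ℕ) (hi : i < D.length), i < j ∧ (D[j]'hj).2 = (D[i]'hi).1 ++ (D[i]'hi).2)

/-- `max{|uv| : u⌢v ∈ D}`: the maximal total length of a rule of `D`. -/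
def maxPairLen (D : Dict α) : ℕ := (D.map (fun r => (r.1 ++ r.2).length)).foldr max 0

/-- `l` is a sufficient lookahead bound for `D`: whenever `𝕋^D(π(φ)π(τ)) = φ⌢τ` with
`|π(τ)| ≥ l`, appending any further text keeps `φ` as a prefix of the tokenization. -/
def GoodLookahead (D : Dict α) (l : ℕ) : Prop :=
  ∀ φ τ ψ : Tok α, l ≤ (pi τ).length →
    IsSP D (pi φ ++ pi τ) (φ ++ τ) →
    ∃ ψ', IsSP D (pi φ ++ pi τ ++ pi ψ) (φ ++ ψ')

/-- The lookahead constant `l(D)`: the smallest sufficient lookahead bound. -/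
noncomputable def lookaheadConst (D : Dict α) : ℕ := sInf {l | GoodLookahead D l}

/-- No rule of `D` applies to `τ`. -/
def NoRedex (D : Dict α) (τ : Tok α) : Prop := ∀ r ∈ D, ¬ Applies r τ

theorem appliesAt_iff {r : Token α × Token α} {τ : Tok α} {p : ℕ} :
    AppliesAt r τ p ↔ τ[p]? = some r.1 ∧ τ[p + 1]? = some r.2 := by
  constructor
  · rintro ⟨φ, φ', rfl, rfl⟩
    simp
  · rintro ⟨h1, h2⟩
    obtain ⟨hp, h1⟩ := List.getElem?_eq_some_iff.1 h1
    obtain ⟨hp', h2⟩ := List.getElem?_eq_some_iff.1 h2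
    refine ⟨τ.take p, τ.drop (p + 2), by simp; omega, ?_⟩
    rw [← h1, ← h2, ← List.drop_eq_getElem_cons hp', ← List.drop_eq_getElem_cons hp,
      List.take_append_drop]

theorem AppliesAt.lt_length {r : Token α × Token α} {τ : Tok α} {p : ℕ}
    (h : AppliesAt r τ p) : p + 1 < τ.length := by
  obtain ⟨φ, φ', rfl, rfl⟩ := h
  simp

theorem appliesAt_append_iff {r : Token α × Token α} {φ s : Tok α} {p : ℕ}
    (hp : p + 1 < φ.length) : AppliesAt r (φ ++ s) p ↔ AppliesAt r φ p := by
  rw [appliesAt_iff, appliesAt_iff, List.getElem?_append_left hp,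
    List.getElem?_append_left (by omega)]

theorem applyAt_append_cons {r : Token α × Token α} (φ φ' : Tok α) :
    applyAt r (φ ++ r.1 :: r.2 :: φ') φ.length = φ ++ (r.1 ++ r.2) :: φ' := by
  simp [applyAt, List.drop_append]

theorem applyAt_append {r : Token α × Token α} {φ : Tok α} (s : Tok α) {p : ℕ}
    (hp : p + 1 < φ.length) : applyAt r (φ ++ s) p = applyAt r φ p ++ s := by
  simp only [applyAt, List.append_assoc, List.cons_append]
  rw [List.take_append_of_le_length (by omega), List.drop_append_of_le_length (by omega)]

theorem length_applyAt {r : Token α × Token α} {φ : Tok α} {p : ℕ}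
    (hp : p + 1 < φ.length) : (applyAt r φ p).length + 1 = φ.length := by
  simp [applyAt]
  omega

theorem getElem?_applyAt_of_lt {r : Token α × Token α} {τ : Tok α} {p q : ℕ}
    (hp : p + 1 < τ.length) (hq : q < p) : (applyAt r τ p)[q]? = τ[q]? := by
  rw [applyAt, List.getElem?_append_left (by simp; omega), List.getElem?_take_of_lt hq]

theorem getElem?_applyAt_of_gt {r : Token α × Token α} {τ : Tok α} {p q : ℕ}
    (hp : p + 1 < τ.length) (hq : p < q) : (applyAt r τ p)[q]? = τ[q + 1]? := by
  obtain ⟨k, rfl⟩ := Nat.exists_eq_add_of_lt hq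
  have hmin : min p τ.length = p := by omega
  rw [applyAt, List.getElem?_append_right (by simp; omega), List.length_take, hmin,
    show p + k + 1 - p = k + 1 by omega, List.getElem?_cons_succ, List.getElem?_drop]
  congr 1
  omega

theorem AppliesAt.of_applyAt_lt {r r' : Token α × Token α} {τ : Tok α} {p q : ℕ}
    (hp : p + 1 < τ.length) (hq : q + 1 < p) (h : AppliesAt r' (applyAt r τ p) q) :
    AppliesAt r' τ q := by
  rw [appliesAt_iff] at h ⊢
  rwa [getElem?_applyAt_of_lt hp (by omega), getElem?_applyAt_of_lt hp hq] at h

theorem AppliesAt.of_applyAt_gt {r r' : Token α × Token α} {τ : Tok α} {p q : ℕ}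
    (hp : p + 1 < τ.length) (hq : p < q) (h : AppliesAt r' (applyAt r τ p) q) :
    AppliesAt r' τ (q + 1) := by
  rw [appliesAt_iff] at h ⊢
  rwa [getElem?_applyAt_of_gt hp hq, getElem?_applyAt_of_gt hp (by omega)] at h

theorem pi_applyAt {r : Token α × Token α} {τ : Tok α} {p : ℕ} (h : AppliesAt r τ p) :
    pi (applyAt r τ p) = pi τ := by
  obtain ⟨φ, φ', rfl, rfl⟩ := h
  rw [applyAt_append_cons]
  simp [pi]

theorem SPStep.bStep {D : Dict α} {τ τ' : Tok α} (h : SPStep D τ τ') : BStep D τ τ' := by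
  obtain ⟨i, p, hi, ⟨φ, φ', rfl, rfl⟩, -, -, rfl⟩ := h
  exact ⟨φ, φ', _, _, List.getElem_mem hi, rfl, applyAt_append_cons φ φ'⟩

theorem SPStep.unique {D : Dict α} {τ τ₁ τ₂ : Tok α} (h₁ : SPStep D τ τ₁)
    (h₂ : SPStep D τ τ₂) : τ₁ = τ₂ := by
  obtain ⟨i, p, hi, ha, hmin, hleft, rfl⟩ := h₁
  obtain ⟨j, q, hj, hb, hmin', hleft', rfl⟩ := h₂
  obtain rfl : i = j := by
    rcases lt_trichotomy i j with h | h | h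
    · exact absurd ⟨p, ha⟩ (hmin' i hi h)
    · exact h
    · exact absurd ⟨q, hb⟩ (hmin j hj h)
  obtain rfl : p = q := by
    rcases lt_trichotomy p q with h | h | h
    · exact absurd ha (hleft' p h)
    · exact h
    · exact absurd hb (hleft q h)
  rfl

/-- If some rule applies, there is a highest priority one with a leftmost occurrence. -/
theorem exists_leftmost {D : Dict α} {τ : Tok α} (h : ¬ NoRedex D τ) :
    ∃ (i p : ℕ) (hi : i < D.length), AppliesAt (D[i]'hi) τ p ∧
      (∀ (j : ℕ) (hj : j < D.length), j < i → ¬ Applies (D[j]'hj) τ) ∧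
      ∀ q < p, ¬ AppliesAt (D[i]'hi) τ q := by
  classical
  have hex : ∃ i, ∃ hi : i < D.length, Applies (D[i]'hi) τ := by
    simp only [NoRedex, not_forall, not_not] at h
    obtain ⟨r, hr, ha⟩ := h
    obtain ⟨i, hi, rfl⟩ := List.mem_iff_getElem.1 hr
    exact ⟨i, hi, ha⟩
  obtain ⟨hi, ha⟩ := Nat.find_spec hex
  have ha' : ∃ p, AppliesAt (D[Nat.find hex]'hi) τ p := ha
  exact ⟨Nat.find hex, Nat.find ha', hi, Nat.find_spec ha',
    fun j hj hlt hA => Nat.find_min hex hlt ⟨hj, hA⟩, fun q hq => Nat.find_min ha' hq⟩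

theorem exists_spStep {D : Dict α} {τ : Tok α} (h : ¬ NoRedex D τ) : ∃ τ', SPStep D τ τ' := by
  obtain ⟨i, p, hi, ha, hmin, hleft⟩ := exists_leftmost h
  exact ⟨_, i, p, hi, ha, hmin, hleft, rfl⟩

theorem noRedex_iff {D : Dict α} {τ : Tok α} : NoRedex D τ ↔ ∀ τ', ¬ SPStep D τ τ' := by
  constructor
  · rintro h τ' ⟨i, p, hi, ha, -⟩
    exact h _ (List.getElem_mem hi) ⟨p, ha⟩
  · intro h
    by_contra hn
    obtain ⟨τ', hτ'⟩ := exists_spStep hn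
    exact h τ' hτ'

theorem NoRedex.eq_of_reflTransGen {D : Dict α} {τ τ' : Tok α} (h : NoRedex D τ)
    (hs : Relation.ReflTransGen (SPStep D) τ τ') : τ = τ' := by
  rcases hs.cases_head with rfl | ⟨_, h', -⟩
  · rfl
  · exact absurd h' (noRedex_iff.1 h _)

theorem BStep.length_lt {D : Dict α} {τ τ' : Tok α} (h : BStep D τ τ') :
    τ'.length < τ.length := by
  obtain ⟨φ, φ', u, v, -, rfl, rfl⟩ := h
  simp

theorem exists_normalForm (D : Dict α) (τ : Tok α) :
    ∃ τ', Relation.ReflTransGen (SPStep D) τ τ' ∧ ∀ τ'', ¬ SPStep D τ' τ'' := by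
  induction hn : τ.length using Nat.strong_induction_on generalizing τ with
  | _ n ih =>
    by_cases h : ∃ τ', SPStep D τ τ'
    · obtain ⟨τ', hτ'⟩ := h
      obtain ⟨N, hN, hN'⟩ := ih _ (hn ▸ hτ'.bStep.length_lt) τ' rfl
      exact ⟨N, .head hτ' hN, hN'⟩
    · exact ⟨τ, .refl, not_exists.1 h⟩

/-- A token bound valid for the rules of `D` is preserved by rewriting. -/
theorem length_le_of_reflTransGen {D : Dict α} {M : ℕ} (hM : ∀ r ∈ D, (r.1 ++ r.2).length ≤ M)
    {τ τ' : Tok α} (h : Relation.ReflTransGen (SPStep D) τ τ') (hτ : ∀ t ∈ τ, t.length ≤ M) :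
    ∀ t ∈ τ', t.length ≤ M := by
  induction h with
  | refl => exact hτ
  | tail _ hs ih =>
    obtain ⟨φ, φ', u, v, hr, rfl, rfl⟩ := hs.bStep
    intro t ht
    simp only [List.mem_append, List.mem_cons] at ht ih
    rcases ht with ht | rfl | ht
    · exact ih t (.inl ht)
    · exact hM _ hr
    · exact ih t (.inr (.inr (.inr ht)))

/-- A rewriting sequence with the rules `D ++ [r]` first normalizes with respect to `D`. -/
theorem exists_normalForm_init {D : Dict α} {r : Token α × Token α} {τ N : Tok α}
    (h : Relation.ReflTransGen (SPStep (D ++ [r])) τ N) (hN : NoRedex (D ++ [r]) N) :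
    ∃ K, Relation.ReflTransGen (SPStep D) τ K ∧ NoRedex D K ∧
      Relation.ReflTransGen (SPStep (D ++ [r])) K N := by
  induction h using Relation.ReflTransGen.head_induction_on with
  | refl => exact ⟨N, .refl, fun r' hr' => hN r' (by simp [hr']), .refl⟩
  | @head a b hab hbN ih =>
    by_cases ha : NoRedex D a
    · exact ⟨a, .refl, ha, .head hab hbN⟩
    · obtain ⟨K, h1, h2, h3⟩ := ih
      refine ⟨K, .head ?_ h1, h2, h3⟩
      obtain ⟨i, p, hi, hA, hmin, hleft⟩ := exists_leftmost ha
      have hstep : SPStep (D ++ [r]) a (applyAt (D[i]'hi) a p) := by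
        refine ⟨i, p, by simp; omega, ?_, ?_, ?_, ?_⟩
        · rwa [List.getElem_append_left hi]
        · intro j hj hji
          rw [List.getElem_append_left (by omega)]
          exact hmin j (by omega) hji
        · rwa [List.getElem_append_left hi]
        · rw [List.getElem_append_left hi]
      rw [hab.unique hstep]
      exact ⟨i, p, hi, hA, hmin, hleft, rfl⟩

/-- `τ` consists of a prefix of `φ₀` followed by a token which reaches position `c` of the
text, or of all of `φ₀` followed by arbitrary tokens. -/
def Frontier (φ₀ : Tok α) (c : ℕ) (τ : Tok α) : Prop :=
  ∃ ψ s, τ = ψ ++ s ∧ ψ <+: φ₀ ∧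
    ((ψ = φ₀ ∧ c ≤ (pi φ₀).length + 1) ∨
      ∃ t s', s = t :: s' ∧ c ≤ (pi ψ).length + t.length)

theorem Frontier.bStep {E : Dict α} (hE : NEDict E) {φ₀ : Tok α} (h₀ : NoRedex E φ₀) {c : ℕ}
    {τ τ' : Tok α} (h : Frontier φ₀ c τ) (hs : BStep E τ τ') : Frontier φ₀ c τ' := by
  obtain ⟨ψ, s, rfl, hψ, hc⟩ := h
  obtain ⟨A, B, u, v, hr, heq, rfl⟩ := hs
  have hv : 0 < v.length := List.length_pos_of_ne_nil (hE _ hr).2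
  have key : ∀ x : Tok α, ψ ++ x = A → s = x ++ u :: v :: B →
      Frontier φ₀ c (A ++ (u ++ v) :: B) := by
    rintro x rfl rfl
    refine ⟨ψ, x ++ (u ++ v) :: B, by simp, hψ, ?_⟩
    rcases hc with hc | ⟨t, s', hts, hc⟩
    · exact .inl hc
    · right
      cases x with
      | nil =>
        obtain ⟨rfl, -⟩ := by simpa using hts
        exact ⟨_, _, rfl, by simp; omega⟩
      | cons y x =>
        obtain ⟨rfl, -⟩ := by simpa using hts
        exact ⟨_, _, rfl, hc⟩
  rcases List.append_eq_append_iff.1 heq with ⟨x, hA, hs⟩ | ⟨x, hψx, hx⟩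
  · exact key x hA.symm hs
  · match x, hx with
    | [], hx => exact key [] (by simp [hψx]) (by simpa using hx.symm)
    | [u'], hx =>
      obtain ⟨rfl, rfl⟩ := by simpa using hx
      subst hψx
      refine ⟨A, _, rfl, (List.prefix_append _ _).trans hψ, .inr ⟨_, _, rfl, ?_⟩⟩
      rcases hc with ⟨rfl, hc⟩ | ⟨t, s', hts, hc⟩
      · simp [pi] at hc ⊢
        omega
      · obtain ⟨rfl, -⟩ := by simpa using hts
        simp [pi] at hc ⊢
        omega
    | u' :: v' :: x, hx =>
      obtain ⟨rfl, rfl, rfl⟩ := by simpa using hx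
      obtain ⟨y, rfl⟩ := hψ
      exact absurd ⟨A.length, A, x ++ y, rfl, by simp [hψx]⟩ (h₀ _ hr)

theorem Frontier.exists_prefix_of_normalForm {E : Dict α} (hE : NEDict E) {φ₀ : Tok α} (h₀ : NoRedex E φ₀)
    {c M : ℕ} (hM : 1 ≤ M) {τ N : Tok α} (h : Frontier φ₀ c τ)
    (hs : Relation.ReflTransGen (SPStep E) τ N) (hN : ∀ t ∈ N, t.length ≤ M) :
    ∃ ψ, ψ <+: φ₀ ∧ ψ <+: N ∧ c ≤ (pi ψ).length + M := by
  have hF : Frontier φ₀ c N := by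
    clear hN
    induction hs with
    | refl => exact h
    | tail _ hs ih => exact ih.bStep hE h₀ hs.bStep
  obtain ⟨ψ, s, rfl, hψ, hc⟩ := hF
  refine ⟨ψ, hψ, List.prefix_append _ _, ?_⟩
  rcases hc with ⟨rfl, hc⟩ | ⟨t, s', rfl, hc⟩
  · omega
  · have := hN t (by simp)
    omega

theorem Frontier.exists_common_prefix_of_normalForm {E : Dict α} (hE : NEDict E) {φ₀ : Tok α}
    (h₀ : NoRedex E φ₀) {c M : ℕ} (hM : 1 ≤ M) {τ : Bool → Tok α} {N : Bool → Tok α}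
    (h : ∀ b, Frontier φ₀ c (τ b)) (hs : ∀ b, Relation.ReflTransGen (SPStep E) (τ b) (N b))
    (hN : ∀ b, ∀ t ∈ N b, t.length ≤ M) :
    ∃ ψ, (∀ b, ψ <+: N b) ∧ c ≤ (pi ψ).length + M := by
  obtain ⟨ψ₁, h₁, h₁', hc₁⟩ := (h true).exists_prefix_of_normalForm hE h₀ hM (hs true) (hN true)
  obtain ⟨ψ₂, h₂, h₂', hc₂⟩ := (h false).exists_prefix_of_normalForm hE h₀ hM (hs false) (hN false)
  rcases le_total ψ₁.length ψ₂.length with hle | hle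
  · have h12 := List.prefix_of_prefix_length_le h₁ h₂ hle
    exact ⟨ψ₁, Bool.forall_bool.2 ⟨h12.trans h₂', h₁'⟩, hc₁⟩
  · have h21 := List.prefix_of_prefix_length_le h₂ h₁ hle
    exact ⟨ψ₂, Bool.forall_bool.2 ⟨h₂', h21.trans h₁'⟩, hc₂⟩

/-- Two tokenizations with a common prefix `φ`, in which only the lowest priority rule of `E`
applies except possibly at the token of index `n`, have normal forms with a common prefix which
is shorter than `φ` by at most the length `M` of a token. -/
theorem exists_common_prefix_of_live {E : Dict α} (hE : NEDict E) {M : ℕ} (hM : 1 ≤ M)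
    {s N : Bool → Tok α} (hN : ∀ b, NoRedex E (N b)) (hNM : ∀ b, ∀ t ∈ N b, t.length ≤ M)
    (φ : Tok α) (n : ℕ) (hn : n < φ.length)
    (hleft : ∀ r ∈ E, ∀ p, p + 1 < n → ¬ AppliesAt r φ p)
    (hright : ∀ b, ∀ (j : ℕ) (hj : j < E.length), j + 1 < E.length → ∀ p, n < p →
      ¬ AppliesAt (E[j]'hj) (φ ++ s b) p)
    (hs : ∀ b, Relation.ReflTransGen (SPStep E) (φ ++ s b) (N b)) :
    ∃ ψ, (∀ b, ψ <+: N b) ∧ (pi φ).length ≤ (pi ψ).length + M ∧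
      (E.length = 1 → (pi φ).length < (pi ψ).length + M) := by
  induction hl : φ.length using Nat.strong_induction_on generalizing φ n with
  | _ l ih =>
  subst hl
  by_cases hφ : NoRedex E φ
  · obtain ⟨ψ, hψ, hc⟩ := Frontier.exists_common_prefix_of_normalForm (c := (pi φ).length + 1) hE hφ hM
      (fun b => ⟨φ, s b, rfl, List.prefix_rfl, .inl ⟨rfl, le_rfl⟩⟩) hs hNM
    exact ⟨ψ, hψ, by omega, fun _ => hc⟩
  by_cases hbad : n + 1 = φ.length ∧ ∃ b, ∃ (j : ℕ) (hj : j < E.length), j + 1 < E.length ∧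
      AppliesAt (E[j]'hj) (φ ++ s b) n
  · obtain ⟨hn1, -, j, hj, hj1, -⟩ := hbad
    have hsplit : φ = φ.take n ++ [φ[n]] := by
      rw [List.take_append_getElem, List.take_of_length_le (by omega)]
    have h₀ : NoRedex E (φ.take n) := by
      rintro r hr ⟨p, hp⟩
      have hlt := hp.lt_length
      rw [List.length_take] at hlt
      refine hleft r hr p (by omega) ?_
      rw [← List.take_append_drop n φ]
      exact (appliesAt_append_iff hp.lt_length).2 hp
    have hlen : (pi φ).length = (pi (φ.take n)).length + φ[n].length := by
      simpa only [pi, List.flatten_append, List.length_append, List.flatten_singleton] using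
        congrArg (fun x => (pi x).length) hsplit
    obtain ⟨ψ, hψ, hc⟩ := Frontier.exists_common_prefix_of_normalForm (c := (pi φ).length) hE h₀ hM
      (fun b => ⟨φ.take n, φ[n] :: s b, by
        rw [List.append_cons, ← hsplit], List.prefix_rfl, .inr ⟨_, _, rfl, hlen.le⟩⟩) hs hNM
    exact ⟨ψ, hψ, hc, fun h => by omega⟩
  obtain ⟨i, p, hi, hA, hmin, hlm⟩ := exists_leftmost hφ
  have hp := hA.lt_length
  have hnp : n ≤ p + 1 := by
    by_contra hlt
    exact hleft _ (List.getElem_mem hi) p (by omega) hA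
  have hpn : i + 1 < E.length → p ≤ n := fun hi1 => by
    by_contra hlt
    exact hright true i hi hi1 p (by omega) ((appliesAt_append_iff hp).2 hA)
  have hmin' : ∀ b, ∀ (j : ℕ) (hj : j < E.length), j < i → ¬ Applies (E[j]'hj) (φ ++ s b) := by
    rintro b j hj hji ⟨q, hq⟩
    have hqn : q ≤ n := by
      by_contra hlt
      exact hright b j hj (by omega) q (by omega) hq
    by_cases hql : q + 1 < φ.length
    · exact hmin j hj hji ⟨q, (appliesAt_append_iff hql).1 hq⟩
    · obtain rfl : q = n := by omega
      exact hbad ⟨by omega, b, j, hj, by omega, hq⟩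
  have hstep : ∀ b, SPStep E (φ ++ s b) (applyAt (E[i]'hi) φ p ++ s b) := fun b =>
    ⟨i, p, hi, (appliesAt_append_iff hp).2 hA, hmin' b,
      fun q hq h => hlm q hq ((appliesAt_append_iff (by omega)).1 h),
      (applyAt_append (s b) hp).symm⟩
  have hlen := length_applyAt (r := E[i]'hi) hp
  rw [← pi_applyAt hA]
  refine ih _ (by omega) (applyAt (E[i]'hi) φ p) p (by omega) ?_ ?_ ?_ rfl
  · intro r hr q hq h
    have h' := h.of_applyAt_lt hp hq
    obtain ⟨j, hj, rfl⟩ := List.mem_iff_getElem.1 hr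
    rcases lt_trichotomy j i with hji | rfl | hji
    · exact hmin j hj hji ⟨q, h'⟩
    · exact hlm q (by omega) h'
    · exact hleft _ hr q (by have := hpn (by omega); omega) h'
  · intro b j hj hj1 q hq h
    rw [← applyAt_append (s b) hp] at h
    have h' := h.of_applyAt_gt (by simp; omega) hq
    by_cases hi1 : i + 1 < E.length
    · exact hright b j hj hj1 (q + 1) (by omega) h'
    · exact hmin' b j hj (by omega) ⟨_, h'⟩
  · intro b
    rcases (hs b).cases_head with h | ⟨τ', h, h'⟩
    · exact absurd (hstep b) (h ▸ noRedex_iff.1 (hN b) _)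
    · rwa [← h.unique (hstep b)]

theorem length_le_of_isSP {D : Dict α} {M : ℕ} (hM : 1 ≤ M)
    (hDM : ∀ r ∈ D, (r.1 ++ r.2).length ≤ M) {w : List α} {τ : Tok α} (h : IsSP D w τ) :
    ∀ t ∈ τ, t.length ≤ M :=
  length_le_of_reflTransGen hDM h.1 (by simpa [TkEmpty] using fun _ _ => hM)

/-- The tokenizations of `w` and `w ++ w'` share a prefix covering all but
`|D| * M` symbols of `w`, and one symbol more if `D` is nonempty. -/
theorem exists_common_prefix_of_isSP {M : ℕ} (hM : 1 ≤ M) (w w' : List α) (D : Dict α) (hD : NEDict D)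
    (hDM : ∀ r ∈ D, (r.1 ++ r.2).length ≤ M) {N : Bool → Tok α}
    (hN : ∀ b, IsSP D (w ++ cond b w' []) (N b)) :
    ∃ ψ, (∀ b, ψ <+: N b) ∧ w.length ≤ (pi ψ).length + D.length * M ∧
      (D ≠ [] → w.length < (pi ψ).length + D.length * M) := by
  induction D using List.reverseRecOn generalizing N with
  | nil =>
    refine ⟨TkEmpty w, fun b => ?_, ?_, by simp⟩
    · rw [← NoRedex.eq_of_reflTransGen (by simp [NoRedex]) (hN b).1]
      simp [TkEmpty]
    · simp [TkEmpty, pi, Function.comp_def]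
  | append_singleton D r ih =>
    have hNr := fun b => noRedex_iff.2 (hN b).2
    choose K hK hKD hKN using fun b => exists_normalForm_init (hN b).1 (hNr b)
    obtain ⟨ψ, hψ, hlen, hlt⟩ := ih (fun r' hr' => hD r' (by simp [hr']))
      (fun r' hr' => hDM r' (by simp [hr'])) (N := K)
      (fun b => ⟨hK b, noRedex_iff.1 (hKD b)⟩)
    have hmul : (D ++ [r]).length * M = D.length * M + M := by simp [Nat.add_mul]
    choose s hs using hψ
    rcases Nat.eq_zero_or_pos ψ.length with h0 | h0
    · obtain rfl := List.length_eq_zero_iff.1 h0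
      refine ⟨[], by simp, ?_, fun _ => ?_⟩ <;> omega
    obtain ⟨χ, hχ, hχlen, hχlt⟩ := exists_common_prefix_of_live (E := D ++ [r]) hD hM hNr
      (fun b => length_le_of_isSP hM hDM (hN b)) ψ 0 h0 (by simp)
      (fun b j hj hj1 p _ h => by
        rw [hs b] at h
        have hjD : j < D.length := by simpa using hj1
        rw [List.getElem_append_left hjD] at h
        exact hKD b _ (List.getElem_mem hjD) ⟨p, h⟩)
      (fun b => (hs b).symm ▸ hKN b)
    refine ⟨χ, hχ, by omega, fun _ => ?_⟩
    rcases eq_or_ne D [] with rfl | hne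
    · have := hχlt (by simp)
      omega
    · have := hlt hne
      omega

theorem length_le_maxPairLen {D : Dict α} {r : Token α × Token α} (hr : r ∈ D) :
    (r.1 ++ r.2).length ≤ maxPairLen D := by
  induction D with
  | nil => simp at hr
  | cons a D ih =>
    have hcons : maxPairLen (a :: D) = max (a.1 ++ a.2).length (maxPairLen D) := rfl
    rw [hcons]
    rcases List.mem_cons.1 hr with rfl | h
    · exact le_max_left _ _
    · exact (ih h).trans (le_max_right _ _)

/-- First-token stability under sufficient lookahead: if `D` is
proper, `|w| ≥ |D|·max{|uv| : u⌢v ∈ D}` and `𝕋^D(w) = u⌢τ`, then for every `w'`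
there is `τ'` with `𝕋^D(ww') = u⌢τ'`. -/
theorem first_token_stable (D : Dict α) (hD : NEDict D) (hP : Proper D)
    (w : List α) (hw : D.length * maxPairLen D ≤ w.length)
    (u : Token α) (τ : Tok α) (h : IsSP D w (u :: τ)) :
    ∀ w' : List α, ∃ τ' : Tok α, IsSP D (w ++ w') (u :: τ') := by
  intro w'
  obtain ⟨N, hN⟩ := exists_normalForm D (TkEmpty (w ++ w'))
  have hNb : ∀ b, IsSP D (w ++ cond b w' []) (cond b N (u :: τ)) :=
    Bool.forall_bool.2 ⟨by simpa using h, hN⟩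
  obtain ⟨ψ, hψ, hne⟩ : ∃ ψ : Tok α, (∀ b, ψ <+: cond b N (u :: τ)) ∧ ψ ≠ [] := by
    rcases eq_or_ne D [] with rfl | hD0
    · obtain ⟨ψ, hψ, hlen, -⟩ := exists_common_prefix_of_isSP le_rfl w w' [] hD (by simp) hNb
      refine ⟨ψ, hψ, ?_⟩
      rintro rfl
      obtain rfl : w = [] := by simpa [pi] using hlen
      simpa [TkEmpty] using NoRedex.eq_of_reflTransGen (by simp [NoRedex]) h.1
    · have hM : 1 ≤ maxPairLen D := by
        obtain ⟨r, hr⟩ := List.exists_mem_of_ne_nil D hD0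
        have h1 := length_le_maxPairLen hr
        have h2 := List.length_pos_of_ne_nil (hD r hr).1
        rw [List.length_append] at h1
        omega
      obtain ⟨ψ, hψ, -, hlt⟩ := exists_common_prefix_of_isSP hM w w' D hD
        (fun r hr => length_le_maxPairLen hr) hNb
      refine ⟨ψ, hψ, ?_⟩
      rintro rfl
      have := hlt hD0
      simp only [pi, List.flatten_nil, List.length_nil] at this
      omega
  obtain ⟨v, ψ, rfl⟩ := List.exists_cons_of_ne_nil hne
  obtain ⟨s, hs⟩ := hψ true
  obtain ⟨rfl, -⟩ := List.cons_prefix_cons.1 (hψ false)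
  obtain rfl : v :: (ψ ++ s) = N := hs
  exact ⟨ψ ++ s, hN⟩
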